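/- Let q be real with 0 < |q| < 1. Define d₃ : ℕ×ℕ×ℤ → ℝ by d₃(r,s,t) = −q^{s+|t|} g(s) · [g(r)/(g(r+s+|t|)g(r+s+|t|+1)) − 1] for t ≥ 0 and (r,s,t) ≠ (0,0,0); d₃(r,s,t) = −q^{s+|t|} g(s+1) · [g(r+1)/(g(r+s+|t|+1)g(r+s+|t|+2)) − 1] for t < 0; and d₃(0,0,0) = 0. Then the diagonal operator on ℓ²(ℕ×ℕ×ℤ) with symbol d₃ is a compact operator. (Moreover there is a constant C > 0 with |d₃(r,s,t)| ≤ C·|q|^{r+s+|t|} for all (r,s,t).) -/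

import Mathlib

noncomputable section

/-- ℓ²(ℕ×ℕ×ℤ) -/
abbrev l2Z3 : Type := lp (fun _ : ℕ × ℕ × ℤ => ℂ) 2

/-- The canonical orthonormal basis vector e(r,s,t) of ℓ²(ℕ×ℕ×ℤ). -/
def e3 (r s : ℕ) (t : ℤ) : l2Z3 := lp.single 2 (r, s, t) 1

/-- g(k) = (1 − q^{2k})^{1/2}  (so g(0) = 0). -/
def gq (q : ℝ) (k : ℕ) : ℝ := Real.sqrt (1 - q ^ (2 * k))

/-- d₃(r,s,t) = −q^{s+|t|} g(s) [g(r)/(g(r+s+|t|)g(r+s+|t|+1)) − 1] for t ≥ 0 and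
(r,s,t) ≠ (0,0,0);  −q^{s+|t|} g(s+1) [g(r+1)/(g(r+s+|t|+1)g(r+s+|t|+2)) − 1] for t < 0;
and d₃(0,0,0) = 0. -/
def d3 (q : ℝ) (r s : ℕ) (t : ℤ) : ℝ :=
  if t < 0 then
    -q ^ (s + t.natAbs) * gq q (s + 1) *
      (gq q (r + 1) / (gq q (r + s + t.natAbs + 1) * gq q (r + s + t.natAbs + 2)) - 1)
  else if r = 0 ∧ s = 0 ∧ t = 0 then 0
  else
    -q ^ (s + t.natAbs) * gq q s *
      (gq q r / (gq q (r + s + t.natAbs) * gq q (r + s + t.natAbs + 1)) - 1)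

section DiagonalOperator

variable {𝕜 E ι : Type*} [RCLike 𝕜] [NormedAddCommGroup E] [InnerProductSpace 𝕜 E]

theorem isCompactOperator_rankOne (x y : E) :
    IsCompactOperator (InnerProductSpace.rankOne 𝕜 x y) := by
  have hid : IsCompactOperator (id : 𝕜 → 𝕜) :=
    (isCompactOperator_id_iff_finiteDimensional (𝕜 := 𝕜)).2 inferInstance
  exact (hid.comp_clm (innerSL 𝕜 y)).clm_comp (ContinuousLinearMap.toSpanSingleton 𝕜 x)

/-- A summable symbol defines a compact diagonal operator along any orthonormal family. -/
theorem Orthonormal.exists_isCompactOperator_diagonal [CompleteSpace E] {v : ι → E}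
    (hv : Orthonormal 𝕜 v) {c : ι → 𝕜} (hc : Summable fun i => ‖c i‖) :
    ∃ D : E →L[𝕜] E, (∀ i, D (v i) = c i • v i) ∧ IsCompactOperator D := by
  have hsum : Summable fun i => c i • InnerProductSpace.rankOne 𝕜 (v i) (v i) := by
    refine Summable.of_norm ?_
    simpa [norm_smul, hv.1] using hc
  refine ⟨∑' i, c i • InnerProductSpace.rankOne 𝕜 (v i) (v i), fun j => ?_, ?_⟩
  · have happ := hsum.hasSum.mapL (ContinuousLinearMap.apply 𝕜 E (v j))
    refine happ.unique ?_
    convert hasSum_single j fun i hij => ?_ using 1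
    · simp [hv.1]
    · simp [hv.2 hij]
  · refine isCompactOperator_of_tendsto hsum.hasSum (Filter.Eventually.of_forall fun t => ?_)
    exact (compactOperator (RingHom.id 𝕜) E E).sum_mem fun i _ =>
      (isCompactOperator_rankOne (v i) (v i)).smul (c i)

end DiagonalOperator

theorem orthonormal_e3 : Orthonormal ℂ fun p : ℕ × ℕ × ℤ => e3 p.1 p.2.1 p.2.2 := by
  classical
  rw [orthonormal_iff_ite]
  rintro ⟨r, s, t⟩ ⟨r', s', t'⟩
  rw [e3, lp.inner_single_left, e3, lp.single_apply]
  by_cases h : (r, s, t) = (r', s', t')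
  · cases h
    simp
  · rw [if_neg h, Pi.single_eq_of_ne h, inner_zero_right]

theorem summable_pow_add_add_natAbs {x : ℝ} (hx0 : 0 ≤ x) (hx1 : x < 1) :
    Summable fun p : ℕ × ℕ × ℤ => x ^ (p.1 + p.2.1 + p.2.2.natAbs) := by
  have hnat := summable_geometric_of_lt_one hx0 hx1
  have hint : Summable fun t : ℤ => x ^ t.natAbs :=
    summable_int_iff_summable_nat_and_neg.2 ⟨by simpa using hnat, by simpa using hnat⟩
  have hprod := hnat.mul_of_nonneg (hnat.mul_of_nonneg hint (fun _ => by positivity)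
    fun _ => by positivity) (fun _ => by positivity) fun _ => by positivity
  refine hprod.congr fun p => ?_
  rw [pow_add, pow_add, mul_assoc]

theorem gq_nonneg (q : ℝ) (k : ℕ) : 0 ≤ gq q k := Real.sqrt_nonneg _

theorem gq_le_one (q : ℝ) (k : ℕ) : gq q k ≤ 1 := by
  have : 0 ≤ q ^ (2 * k) := by
    rw [pow_mul]
    positivity
  exact Real.sqrt_le_iff.2 ⟨zero_le_one, by linarith⟩

theorem gq_sq {q : ℝ} (hq : |q| ≤ 1) (k : ℕ) : gq q k ^ 2 = 1 - q ^ (2 * k) := by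
  rw [gq, Real.sq_sqrt]
  rw [pow_mul, sub_nonneg]
  exact pow_le_one₀ (sq_nonneg q) ((sq_le_one_iff_abs_le_one q).2 hq)

theorem gq_mono {q : ℝ} (hq : |q| ≤ 1) : Monotone (gq q) := by
  intro k l hkl
  refine Real.sqrt_le_sqrt (sub_le_sub_left ?_ 1)
  rw [pow_mul, pow_mul]
  exact pow_le_pow_of_le_one (sq_nonneg q) ((sq_le_one_iff_abs_le_one q).2 hq) hkl

theorem abs_gq_div_sub_one_le {q : ℝ} (hq : |q| < 1) {k m : ℕ} (hkm : k ≤ m) (hm : 1 ≤ m) :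
    |gq q k / (gq q m * gq q (m + 1)) - 1| ≤ (1 - q ^ 2)⁻¹ * |q| ^ k := by
  have hq2 : 0 < 1 - q ^ 2 := by
    have := (sq_lt_one_iff_abs_lt_one q).2 hq
    linarith
  have hmono := gq_mono hq.le
  have hlow : gq q m ^ 2 ≤ gq q m * gq q (m + 1) := by
    rw [sq]
    exact mul_le_mul_of_nonneg_left (hmono m.le_succ) (gq_nonneg q m)
  have hlow_one : 1 - q ^ 2 ≤ gq q m * gq q (m + 1) := by
    refine le_trans ?_ hlow
    calc 1 - q ^ 2 = gq q 1 ^ 2 := by rw [gq_sq hq.le]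
      _ ≤ gq q m ^ 2 := pow_le_pow_left₀ (gq_nonneg q 1) (hmono hm) 2
  have hlow_k : 1 - q ^ (2 * k) ≤ gq q m * gq q (m + 1) := by
    refine le_trans ?_ hlow
    rw [← gq_sq hq.le]
    exact pow_le_pow_left₀ (gq_nonneg q k) (hmono hkm) 2
  have hup : gq q m * gq q (m + 1) ≤ 1 :=
    mul_le_one₀ (gq_le_one q m) (gq_nonneg q _) (gq_le_one q _)
  have hk_low : 1 - q ^ (2 * k) ≤ gq q k := by
    rw [← gq_sq hq.le, sq]
    exact mul_le_of_le_one_left (gq_nonneg q k) (gq_le_one q k)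
  have hpow : q ^ (2 * k) ≤ |q| ^ k := by
    rw [pow_mul, ← sq_abs, ← pow_mul]
    exact pow_le_pow_of_le_one (abs_nonneg q) hq.le (by omega)
  have hpos : 0 < gq q m * gq q (m + 1) := hq2.trans_le hlow_one
  have hdiff : |gq q k - gq q m * gq q (m + 1)| ≤ |q| ^ k := by
    rw [abs_le]
    constructor <;> linarith [gq_le_one q k]
  rw [div_sub_one hpos.ne', abs_div, abs_of_pos hpos, div_eq_inv_mul]
  gcongr

theorem abs_neg_pow_mul_gq_mul_le {q b B : ℝ} (n l k : ℕ) (hb : |b| ≤ B * |q| ^ k) :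
    |-q ^ n * gq q l * b| ≤ B * |q| ^ (k + n) := by
  rw [abs_mul, abs_mul, abs_neg, abs_pow, abs_of_nonneg (gq_nonneg q l)]
  calc |q| ^ n * gq q l * |b| ≤ |q| ^ n * 1 * (B * |q| ^ k) := by
        gcongr
        exact gq_le_one q l
    _ = B * |q| ^ (k + n) := by ring

theorem abs_d3_le {q : ℝ} (hq : |q| < 1) (r s : ℕ) (t : ℤ) :
    |d3 q r s t| ≤ (1 - q ^ 2)⁻¹ * |q| ^ (r + s + t.natAbs) := by
  have hinv : 0 < (1 - q ^ 2)⁻¹ := by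
    rw [inv_pos, sub_pos]
    exact (sq_lt_one_iff_abs_lt_one q).2 hq
  rw [add_assoc, d3]
  split_ifs with ht hzero
  · refine abs_neg_pow_mul_gq_mul_le _ _ _
      ((abs_gq_div_sub_one_le hq (by omega) (by omega)).trans ?_)
    exact mul_le_mul_of_nonneg_left
      (pow_le_pow_of_le_one (abs_nonneg q) hq.le r.le_succ) hinv.le
  · rw [abs_zero]
    positivity
  · exact abs_neg_pow_mul_gq_mul_le _ _ _
      (abs_gq_div_sub_one_le hq (by omega) (by omega))

/-- the diagonal operator with symbol d₃ is compact; moreover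
|d₃(r,s,t)| ≤ C·|q|^{r+s+|t|} for some C > 0. -/
theorem stmt14 (q : ℝ) (h0 : 0 < |q|) (h1 : |q| < 1) :
    (∃ D : l2Z3 →L[ℂ] l2Z3,
      (∀ (r s : ℕ) (t : ℤ), D (e3 r s t) = ((d3 q r s t : ℝ) : ℂ) • e3 r s t) ∧
      IsCompactOperator (⇑D)) ∧
    ∃ C : ℝ, 0 < C ∧ ∀ (r s : ℕ) (t : ℤ),
      |d3 q r s t| ≤ C * |q| ^ (r + s + t.natAbs) := by
  refine ⟨?_, (1 - q ^ 2)⁻¹, ?_, abs_d3_le h1⟩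
  · have hsummable : Summable fun p : ℕ × ℕ × ℤ => ‖((d3 q p.1 p.2.1 p.2.2 : ℝ) : ℂ)‖ := by
      refine Summable.of_nonneg_of_le (fun _ => norm_nonneg _) (fun p => ?_)
        ((summable_pow_add_add_natAbs (abs_nonneg q) h1).mul_left (1 - q ^ 2)⁻¹)
      rw [Complex.norm_real, Real.norm_eq_abs]
      exact abs_d3_le h1 p.1 p.2.1 p.2.2
    obtain ⟨D, hD, hcompact⟩ := orthonormal_e3.exists_isCompactOperator_diagonal hsummable
    exact ⟨D, fun r s t => hD (r, s, t), hcompact⟩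
  · rw [inv_pos, sub_pos]
    exact (sq_lt_one_iff_abs_lt_one q).2 h1
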